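/- arXiv:2604.18014 — 6 statements merged into one kernel-verified Lean document; each statement's English description precedes it below -/
import Mathlib

section
/- For all positive integers m, n and every stream x : Fin m → Fin n, the average of the estimator over a uniformly random position equals the Shannon entropy of the stream: (1/m) · Σ_{q=1}^{m} (λ_m(r_q) − λ_m(r_q − 1)) = Σ_{i : m_i > 0} (m_i/m) · log₂(m/m_i). -/
open Finset

/-- `lam m r = r * log₂(m/r)` for `r ≥ 1`, and `lam m 0 = 0`. -/
noncomputable def lam (m r : ℕ) : ℝ :=
  if r = 0 then 0 else (r : ℝ) * Real.logb 2 ((m : ℝ) / (r : ℝ))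

/-- Frequency of symbol `i` in the stream `x`. -/
def freq {m n : ℕ} (x : Fin m → Fin n) (i : Fin n) : ℕ :=
  (Finset.univ.filter (fun j => x j = i)).card

/-- `suffCount x q` = number of occurrences of `x q` from position `q` to the end. -/
def suffCount {m n : ℕ} (x : Fin m → Fin n) (q : Fin m) : ℕ :=
  (Finset.univ.filter (fun j => q ≤ j ∧ x j = x q)).card

/-- Summing the increments of `f` along the ranks, counted from the top, of the elements of a
finite set telescopes. -/
theorem sum_sub_card_filter_le {α : Type*} [LinearOrder α] (f : ℕ → ℝ) (s : Finset α) :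
    ∑ q ∈ s, (f #{j ∈ s | q ≤ j} - f (#{j ∈ s | q ≤ j} - 1)) = f #s - f 0 := by
  induction s using Finset.induction_on_min with
  | empty => simp
  | insert a s ha ih =>
    have has : a ∉ s := fun h => lt_irrefl _ (ha a h)
    have hfilter_min : {j ∈ insert a s | a ≤ j} = insert a s :=
      Finset.filter_true_of_mem fun j hj =>
        (Finset.mem_insert.1 hj).elim (fun h => h.ge) fun h => (ha j h).le
    have hfilter : ∀ q ∈ s, {j ∈ insert a s | q ≤ j} = {j ∈ s | q ≤ j} := fun q hq => by
      rw [Finset.filter_insert, if_neg (ha q hq).not_ge]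
    rw [Finset.sum_insert has, hfilter_min,
      Finset.sum_congr rfl fun q hq => by rw [hfilter q hq], ih, Finset.card_insert_of_notMem has,
      Nat.add_sub_cancel]
    ring

theorem sum_lam_sub_lam {m n : ℕ} (x : Fin m → Fin n) :
    ∑ q : Fin m, (lam m (suffCount x q) - lam m (suffCount x q - 1)) =
      ∑ i : Fin n, lam m (freq x i) := by
  rw [← Finset.sum_fiberwise Finset.univ x]
  refine Finset.sum_congr rfl fun i _ => ?_
  have htelescope := sum_sub_card_filter_le (lam m) {j | x j = i}
  rw [show lam m 0 = 0 from if_pos rfl, sub_zero] at htelescope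
  rw [freq, ← htelescope]
  refine Finset.sum_congr rfl fun q hq => ?_
  have hcount : suffCount x q = #{j ∈ ({j | x j = i} : Finset (Fin m)) | q ≤ j} := by
    rw [suffCount, (Finset.mem_filter.1 hq).2, Finset.filter_filter]
    simp only [and_comm]
  rw [hcount]

theorem stmt_0 (m n : ℕ) (hm : 0 < m) (hn : 0 < n) (x : Fin m → Fin n) :
    (1 / (m : ℝ)) * ∑ q : Fin m, (lam m (suffCount x q) - lam m (suffCount x q - 1)) =
      ∑ i ∈ Finset.univ.filter (fun i => 0 < freq x i),
        ((freq x i : ℝ) / m) * Real.logb 2 ((m : ℝ) / (freq x i : ℝ)) := by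
  rw [sum_lam_sub_lam, Finset.mul_sum, Finset.sum_filter]
  refine Finset.sum_congr rfl fun i _ => ?_
  rcases Nat.eq_zero_or_pos (freq x i) with h | h
  · simp [h, lam]
  · rw [if_pos h, lam, if_neg h.ne']
    ring
end

section
/- For every integer m ≥ 1 and every integer r with 1 ≤ r ≤ m, the increment is bounded as −log₂ e ≤ λ_m(r) − λ_m(r − 1) ≤ log₂ m. -/
theorem lam_eq_div_log_two {m : ℕ} (hm : 1 ≤ m) (r : ℕ) :
    lam m r = (r * Real.log m - r * Real.log r) / Real.log 2 := by
  rcases Nat.eq_zero_or_pos r with rfl | hr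
  · simp [lam]
  · have hm' : (m : ℝ) ≠ 0 := by positivity
    have hr' : (r : ℝ) ≠ 0 := by positivity
    rw [lam, if_neg hr.ne', Real.logb, Real.log_div hm' hr']
    ring

theorem mul_log_succ_sub_log_le_one (s : ℕ) :
    (s : ℝ) * (Real.log (s + 1) - Real.log s) ≤ 1 := by
  rcases Nat.eq_zero_or_pos s with rfl | hs
  · simp
  · have hs' : (0 : ℝ) < s := by exact_mod_cast hs
    rw [← Real.log_div (by positivity) hs'.ne']
    calc (s : ℝ) * Real.log ((s + 1) / s) ≤ s * ((s + 1) / s - 1) := by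
          gcongr
          exact Real.log_le_sub_one_of_pos (by positivity)
      _ = 1 := by field_simp; ring

theorem natCast_mul_log_le_succ (s : ℕ) :
    (s : ℝ) * Real.log s ≤ (s + 1) * Real.log (s + 1) := by
  rcases Nat.eq_zero_or_pos s with rfl | hs
  · simp
  · have hs' : (1 : ℝ) ≤ s := by exact_mod_cast hs
    have := Real.log_nonneg hs'
    gcongr <;> linarith

theorem stmt_2 (m r : ℕ) (hm : 1 ≤ m) (hr1 : 1 ≤ r) (hrm : r ≤ m) :
    -Real.logb 2 (Real.exp 1) ≤ lam m r - lam m (r - 1) ∧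
      lam m r - lam m (r - 1) ≤ Real.logb 2 m := by
  obtain ⟨s, rfl⟩ : ∃ s, r = s + 1 := ⟨r - 1, by omega⟩
  have h2 : 0 < Real.log 2 := Real.log_pos one_lt_two
  have hlog : Real.log ((s : ℝ) + 1) ≤ Real.log m :=
    Real.log_le_log (by positivity) (by exact_mod_cast hrm)
  have hlower := mul_log_succ_sub_log_le_one s
  have hupper := natCast_mul_log_le_succ s
  rw [Nat.add_sub_cancel, lam_eq_div_log_two hm, lam_eq_div_log_two hm, ← sub_div, Real.logb,
    Real.logb, Real.log_exp, ← neg_div, div_le_div_iff_of_pos_right h2,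
    div_le_div_iff_of_pos_right h2]
  push_cast
  constructor <;> linarith
end

section
/- Let m ≥ 1 and d be integers with 0 ≤ d ≤ m, set H := log₂ m + d/m, and let ε ≥ 0 be a real number with ε · (log₂ m + 1) < 1/√m. For every real H̃ with |H̃ − H| ≤ ε · H: if d ≤ m/2 − √m then H̃ < log₂ m + 1/2, and if d ≥ m/2 + √m then H̃ > log₂ m + 1/2. -/
theorem stmt_12 (m d : ℕ) (hm : 1 ≤ m) (hd : d ≤ m) (ε : ℝ) (hε0 : 0 ≤ ε)
    (hε : ε * (Real.logb 2 m + 1) < 1 / Real.sqrt m)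
    (Ht : ℝ)
    (happ : |Ht - (Real.logb 2 m + (d : ℝ) / m)| ≤ ε * (Real.logb 2 m + (d : ℝ) / m)) :
    ((d : ℝ) ≤ (m : ℝ) / 2 - Real.sqrt m → Ht < Real.logb 2 m + 1 / 2) ∧
      ((d : ℝ) ≥ (m : ℝ) / 2 + Real.sqrt m → Ht > Real.logb 2 m + 1 / 2) := by
  have hm0 : (0 : ℝ) < m := by exact_mod_cast hm
  have hdm : (d : ℝ) / m ≤ 1 := (div_le_one hm0).mpr (by exact_mod_cast hd)
  have herr : ε * (Real.logb 2 m + (d : ℝ) / m) < 1 / Real.sqrt m :=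
    (mul_le_mul_of_nonneg_left (by linarith) hε0).trans_lt hε
  have hinv : 1 / Real.sqrt m * m = Real.sqrt m := by
    rw [one_div, inv_mul_eq_div, Real.div_sqrt]
  obtain ⟨hlower, hupper⟩ := abs_le.mp happ
  constructor
  · intro hnear
    have : (d : ℝ) / m ≤ 1 / 2 - 1 / Real.sqrt m := by
      rw [div_le_iff₀ hm0, sub_mul, hinv]
      linarith
    linarith
  · intro hfar
    have : 1 / 2 + 1 / Real.sqrt m ≤ (d : ℝ) / m := by
      rw [le_div_iff₀ hm0, add_mul, hinv]
      linarith
    linarith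
end

section
/- Let m ≥ 1 be an integer and x, y : Fin m → Fin 2 be two binary strings, and let d(x,y) := #{j : x_j ≠ y_j} denote their Hamming distance. Define the concatenated stream A of length 2m over the alphabet Fin (2m) by A_j := j + m·x_j for the first m positions j ∈ Fin m and A_{m+j} := j + m·y_j for the last m positions. Then every value of Fin (2m) occurs at most twice in A; exactly m − d(x,y) values occur exactly twice, and exactly 2·d(x,y) values occur exactly once. -/
/-- A sum over `Fin (2 * m)`, with each index written as `j + m * b` for a bit `b`. -/
theorem Fin.sum_two_mul_eq_sum_bits {M : Type*} [AddCommMonoid M] {m : ℕ} (f : Fin (2 * m) → M) :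
    ∑ v, f v = ∑ j : Fin m, (f (finProdFinEquiv (0, j)) + f (finProdFinEquiv (1, j))) := by
  rw [← finProdFinEquiv.sum_comp, Fintype.sum_prod_type, Fin.sum_univ_two,
    Finset.sum_add_distrib]

/-- The multiplicity of the symbol `j + m * b` in the concatenated encodings of `x` and `y`. -/
theorem card_fiber_concat_encoding {m : ℕ} {x y : Fin m → Fin 2} {A : Fin (2 * m) → Fin (2 * m)}
    (hx : ∀ j, A (finProdFinEquiv (0, j)) = finProdFinEquiv (x j, j))
    (hy : ∀ j, A (finProdFinEquiv (1, j)) = finProdFinEquiv (y j, j)) (b : Fin 2) (j : Fin m) :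
    (Finset.univ.filter (fun k => A k = finProdFinEquiv (b, j))).card =
      (if x j = b then 1 else 0) + (if y j = b then 1 else 0) := by
  rw [Finset.card_filter, Fin.sum_two_mul_eq_sum_bits, Finset.sum_eq_single j]
  · simp [hx, hy]
  · intro i _ hij
    simp [hx, hy, hij]
  · simp

theorem stmt_15 (m : ℕ) (hm : 1 ≤ m) (x y : Fin m → Fin 2)
    (A : Fin (2 * m) → Fin (2 * m))
    (hA1 : ∀ j : Fin m,
      (A ⟨(j : ℕ), by have := j.isLt; omega⟩ : ℕ) = (j : ℕ) + m * (x j : ℕ))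
    (hA2 : ∀ j : Fin m,
      (A ⟨m + (j : ℕ), by have := j.isLt; omega⟩ : ℕ) = (j : ℕ) + m * (y j : ℕ)) :
    (∀ v : Fin (2 * m), (Finset.univ.filter (fun k => A k = v)).card ≤ 2) ∧
      (Finset.univ.filter (fun v : Fin (2 * m) =>
          (Finset.univ.filter (fun k => A k = v)).card = 2)).card =
        m - (Finset.univ.filter (fun j => x j ≠ y j)).card ∧
      (Finset.univ.filter (fun v : Fin (2 * m) =>
          (Finset.univ.filter (fun k => A k = v)).card = 1)).card =
        2 * (Finset.univ.filter (fun j => x j ≠ y j)).card := by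
  have hx : ∀ j, A (finProdFinEquiv (0, j)) = finProdFinEquiv (x j, j) := fun j => by
    rw [Fin.ext_iff, finProdFinEquiv_apply_val, ← hA1 j]
    congr 2
  have hy : ∀ j, A (finProdFinEquiv (1, j)) = finProdFinEquiv (y j, j) := fun j => by
    rw [Fin.ext_iff, finProdFinEquiv_apply_val, ← hA2 j]
    congr 2
    simp [Fin.ext_iff, add_comm]
  have mult := card_fiber_concat_encoding hx hy
  refine ⟨fun v => ?_, ?_, ?_⟩
  · obtain ⟨⟨b, j⟩, rfl⟩ := finProdFinEquiv.surjective v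
    rw [mult]
    split_ifs <;> simp
  · have hcompl : (Finset.univ.filter (fun j => x j = y j)).card +
        (Finset.univ.filter (fun j => x j ≠ y j)).card = m := by
      simpa using Finset.card_filter_add_card_filter_not (s := Finset.univ) (fun j => x j = y j)
    rw [← Nat.eq_sub_of_add_eq hcompl, Finset.card_filter, Finset.card_filter,
      Fin.sum_two_mul_eq_sum_bits]
    refine Finset.sum_congr rfl fun j _ => ?_
    rw [mult, mult]
    generalize x j = a
    generalize y j = b
    revert a b
    decide
  · rw [Finset.card_filter _ Finset.univ, Finset.card_filter (fun j => x j ≠ y j),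
      Fin.sum_two_mul_eq_sum_bits, Finset.mul_sum]
    refine Finset.sum_congr rfl fun j _ => ?_
    rw [mult, mult]
    generalize x j = a
    generalize y j = b
    revert a b
    decide
end

section
/- Let m ≥ 1 be an integer and x, y : Fin m → Fin 2 two binary strings with Hamming distance d := #{j : x_j ≠ y_j}, and let A be the concatenated stream of length 2m over Fin (2m) given by A_j := j + m·x_j for the first m positions and A_{m+j} := j + m·y_j for the last m positions. Then the Shannon entropy of the empirical distribution of A equals log₂ m + d/m. -/
theorem Fin.sum_univ_two_mul {M : Type*} [AddCommMonoid M] (m : ℕ) (f : Fin (2 * m) → M) :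
    ∑ v, f v = ∑ j : Fin m, (f ⟨(j : ℕ), j.isLt.trans_le (Nat.le_mul_of_pos_left m two_pos)⟩ +
      f ⟨m + (j : ℕ), (Nat.add_lt_add_left j.isLt m).trans_eq (two_mul m).symm⟩) := by
  rw [Finset.sum_add_distrib,
    ← (finCongr (two_mul m).symm).sum_comp f, Fin.sum_univ_add]
  rfl

theorem Nat.add_mul_eq_add_mul_iff {m : ℕ} (i j : Fin m) (a b : Fin 2) :
    (i : ℕ) + m * (a : ℕ) = (j : ℕ) + m * (b : ℕ) ↔ i = j ∧ a = b := by
  have hi := i.isLt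
  have hj := j.isLt
  fin_cases a <;> fin_cases b <;> simp [Fin.ext_iff] <;> omega

/-- The number of occurrences of the symbol `j + m * b` in the stream. -/
theorem card_filter_stream_eq {m : ℕ} {x y : Fin m → Fin 2} {A : Fin (2 * m) → Fin (2 * m)}
    (hA1 : ∀ j : Fin m,
      (A ⟨(j : ℕ), j.isLt.trans_le (Nat.le_mul_of_pos_left m two_pos)⟩ : ℕ) =
        (j : ℕ) + m * (x j : ℕ))
    (hA2 : ∀ j : Fin m,
      (A ⟨m + (j : ℕ), (Nat.add_lt_add_left j.isLt m).trans_eq (two_mul m).symm⟩ : ℕ) =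
        (j : ℕ) + m * (y j : ℕ))
    (j : Fin m) (b : Fin 2) (v : Fin (2 * m)) (hv : (v : ℕ) = (j : ℕ) + m * (b : ℕ)) :
    (Finset.univ.filter (fun k => A k = v)).card =
      (if x j = b then 1 else 0) + (if y j = b then 1 else 0) := by
  rw [Finset.card_filter, Fin.sum_univ_two_mul, Finset.sum_add_distrib]
  simp only [Fin.ext_iff (b := v), hA1, hA2, hv, Nat.add_mul_eq_add_mul_iff, ite_and,
    Finset.sum_ite_eq', Finset.mem_univ, if_true]

theorem stmt_16 (m : ℕ) (hm : 1 ≤ m) (x y : Fin m → Fin 2)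
    (A : Fin (2 * m) → Fin (2 * m))
    (hA1 : ∀ j : Fin m,
      (A ⟨(j : ℕ), by have := j.isLt; omega⟩ : ℕ) = (j : ℕ) + m * (x j : ℕ))
    (hA2 : ∀ j : Fin m,
      (A ⟨m + (j : ℕ), by have := j.isLt; omega⟩ : ℕ) = (j : ℕ) + m * (y j : ℕ)) :
    ∑ v ∈ Finset.univ.filter (fun v : Fin (2 * m) =>
        0 < (Finset.univ.filter (fun k => A k = v)).card),
      (((Finset.univ.filter (fun k => A k = v)).card : ℝ) / (2 * m)) *
        Real.logb 2 ((2 * (m : ℝ)) / ((Finset.univ.filter (fun k => A k = v)).card : ℝ)) =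
      Real.logb 2 m + ((Finset.univ.filter (fun j => x j ≠ y j)).card : ℝ) / m := by
  have hm0 : (m : ℝ) ≠ 0 := by positivity
  have hlog : Real.logb 2 (2 * (m : ℝ)) = 1 + Real.logb 2 m := by
    rw [Real.logb_mul two_ne_zero hm0, Real.logb_self_eq_one one_lt_two]
  rw [Finset.sum_filter_of_ne, Fin.sum_univ_two_mul]
  · trans ∑ j : Fin m, (Real.logb 2 m / m + (if x j ≠ y j then (1 : ℝ) else 0) / m)
    · refine Finset.sum_congr rfl fun j _ => ?_
      rw [card_filter_stream_eq hA1 hA2 j 0 ⟨(j : ℕ), _⟩ (by simp),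
        card_filter_stream_eq hA1 hA2 j 1 ⟨m + (j : ℕ), _⟩ (by simp [add_comm])]
      generalize x j = a
      generalize y j = b
      fin_cases a <;> fin_cases b <;> simp [hlog, one_add_one_eq_two] <;> field_simp <;> ring
    · rw [Finset.sum_add_distrib, ← Finset.sum_div, ← Finset.sum_div, Finset.card_filter]
      push_cast
      simp [hm0]
  · intro v _ h
    contrapose! h
    simp [Nat.le_zero.mp h]
end

section
/- Let x : Fin m → Fin n be a stream (m, n positive integers) containing a symbol a whose frequency m_a satisfies m/2 < m_a < m. Then (1/(m − m_a)) · Σ_{q : x_q ≠ a} (λ_m(r_q) − λ_m(r_q − 1)) ≥ 1. -/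
open Finset

theorem suffCount_pos {m n : ℕ} (x : Fin m → Fin n) (q : Fin m) : 1 ≤ suffCount x q :=
  Finset.card_pos.mpr ⟨q, by simp⟩

theorem suffCount_le_freq {m n : ℕ} (x : Fin m → Fin n) (q : Fin m) :
    suffCount x q ≤ freq x (x q) := by
  apply Finset.card_le_card
  intro j hj
  simp only [Finset.mem_filter, Finset.mem_univ, true_and] at hj ⊢
  exact hj.2

theorem suffCount_lt_of_lt {m n : ℕ} (x : Fin m → Fin n) {p q : Fin m} (hpq : p < q)
    (hx : x p = x q) : suffCount x q < suffCount x p := by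
  apply Finset.card_lt_card
  rw [Finset.ssubset_iff_of_subset]
  · exact ⟨p, by simp, by simp [hpq]⟩
  · intro j hj
    simp only [Finset.mem_filter, Finset.mem_univ, true_and] at hj ⊢
    exact ⟨hpq.le.trans hj.1, hj.2.trans hx.symm⟩

theorem suffCount_injOn {m n : ℕ} (x : Fin m → Fin n) (i : Fin n) :
    Set.InjOn (suffCount x) (Finset.univ.filter (fun q => x q = i) : Finset (Fin m)) := by
  intro p hp q hq h
  simp only [Finset.coe_filter, Finset.mem_univ, true_and, Set.mem_ofPred_eq] at hp hq
  rcases lt_trichotomy p q with hlt | heq | hlt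
  · exact absurd h (suffCount_lt_of_lt x hlt (hp.trans hq.symm)).ne'
  · exact heq
  · exact absurd h (suffCount_lt_of_lt x hlt (hq.trans hp.symm)).ne

theorem image_suffCount {m n : ℕ} (x : Fin m → Fin n) (i : Fin n) :
    (Finset.univ.filter (fun q => x q = i)).image (suffCount x) = Finset.Icc 1 (freq x i) := by
  apply Finset.eq_of_subset_of_card_le
  · intro r hr
    simp only [Finset.mem_image, Finset.mem_filter, Finset.mem_univ, true_and] at hr
    obtain ⟨q, rfl, rfl⟩ := hr
    exact Finset.mem_Icc.mpr ⟨suffCount_pos x q, suffCount_le_freq x q⟩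
  · rw [Finset.card_image_of_injOn (suffCount_injOn x i)]
    simp [freq]

theorem sum_Icc_sub_pred (f : ℕ → ℝ) (k : ℕ) :
    ∑ r ∈ Finset.Icc 1 k, (f r - f (r - 1)) = f k - f 0 := by
  induction k with
  | zero => simp
  | succ k ih =>
    rw [Finset.sum_Icc_succ_top (by omega), ih, Nat.add_sub_cancel]
    ring

/-- Over the positions of one symbol, the increments of `lam` telescope. -/
theorem sum_lam_sub_eq_lam_freq {m n : ℕ} (x : Fin m → Fin n) (i : Fin n) :
    ∑ q ∈ Finset.univ.filter (fun q => x q = i),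
      (lam m (suffCount x q) - lam m (suffCount x q - 1)) = lam m (freq x i) := by
  rw [← Finset.sum_image (f := fun r => lam m r - lam m (r - 1)) (suffCount_injOn x i),
    image_suffCount, sum_Icc_sub_pred]
  simp [lam]

theorem le_lam_of_two_mul_le {m r : ℕ} (h : 2 * r ≤ m) : (r : ℝ) ≤ lam m r := by
  rcases Nat.eq_zero_or_pos r with rfl | hr
  · simp [lam]
  · have hr' : (0 : ℝ) < r := by exact_mod_cast hr
    have h2 : (2 : ℝ) ≤ (m : ℝ) / r := by
      rw [le_div_iff₀ hr']
      exact_mod_cast h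
    have hlog : 1 ≤ Real.logb 2 ((m : ℝ) / r) := by
      rw [Real.le_logb_iff_rpow_le (by norm_num) (by linarith)]
      simpa using h2
    rw [lam, if_neg hr.ne']
    nlinarith

theorem freq_add_freq_le {m n : ℕ} (x : Fin m → Fin n) {i a : Fin n} (h : i ≠ a) :
    freq x i + freq x a ≤ m := by
  have hd : Disjoint (Finset.univ.filter (fun j => x j = i))
      (Finset.univ.filter (fun j => x j = a)) :=
    Finset.disjoint_filter.mpr fun j _ h1 h2 => h (h1.symm.trans h2)
  rw [freq, freq, ← Finset.card_union_of_disjoint hd]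
  simpa using Finset.card_le_univ (α := Fin m) _

theorem sum_filter_ne_eq_sum_fiber {m n : ℕ} (x : Fin m → Fin n) (a : Fin n) (g : Fin m → ℝ) :
    ∑ q ∈ Finset.univ.filter (fun q => x q ≠ a), g q =
      ∑ i ∈ Finset.univ.erase a, ∑ q ∈ Finset.univ.filter (fun q => x q = i), g q := by
  rw [← Finset.sum_fiberwise_of_maps_to (t := Finset.univ.erase a) (g := x) (by simp)]
  refine Finset.sum_congr rfl fun i hi => Finset.sum_congr ?_ fun _ _ => rfl
  ext q
  simp only [Finset.mem_filter, Finset.mem_univ, true_and, and_iff_right_iff_imp]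
  rintro rfl
  exact Finset.ne_of_mem_erase hi

theorem sum_erase_freq {m n : ℕ} (x : Fin m → Fin n) (a : Fin n) :
    ∑ i ∈ Finset.univ.erase a, (freq x i : ℝ) = m - freq x a := by
  have htotal : ∑ i, freq x i = m := by
    simpa [freq] using
      (Finset.card_eq_sum_card_fiberwise (s := Finset.univ) (t := Finset.univ) (f := x)
        (by simp)).symm
  rw [Finset.sum_erase_eq_sub (Finset.mem_univ a)]
  exact_mod_cast congrArg (fun k : ℕ => (k : ℝ) - freq x a) htotal

theorem stmt_18 (m n : ℕ) (hm : 0 < m) (hn : 0 < n) (x : Fin m → Fin n) (a : Fin n)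
    (ha1 : (m : ℝ) / 2 < (freq x a : ℝ)) (ha2 : freq x a < m) :
    (1 / ((m : ℝ) - (freq x a : ℝ))) *
        ∑ q ∈ Finset.univ.filter (fun q => x q ≠ a),
          (lam m (suffCount x q) - lam m (suffCount x q - 1)) ≥ 1 := by
  have hpos : (0 : ℝ) < (m : ℝ) - freq x a := sub_pos.mpr (by exact_mod_cast ha2)
  have hmaj : m < 2 * freq x a := by
    have : (m : ℝ) < 2 * freq x a := by linarith
    exact_mod_cast this
  rw [ge_iff_le, one_div_mul_eq_div, one_le_div hpos, sum_filter_ne_eq_sum_fiber,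
    ← sum_erase_freq x a]
  refine Finset.sum_le_sum fun i hi => ?_
  rw [sum_lam_sub_eq_lam_freq]
  have := freq_add_freq_le x (Finset.ne_of_mem_erase hi)
  exact le_lam_of_two_mul_le (by omega)
end
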